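/- Let (X,d) be a metric space with marked point p. The inequality (1/3)(ρ²(α,β)+ρ²(β,γ)+ρ²(γ,α)) ≤ ρ²(α,η)+ρ²(β,η)+ρ²(γ,η) holds for every pretangent space Ω_{p,r̃}^X (over all normalizing sequences r̃ and all maximal self-stable families) and all points α,β,γ,η ∈ Ω_{p,r̃}^X if and only if liminf_{w,x,y,z→p} A₂(w,x,y,z) ≥ 0. -/

import Mathlib

open Filter Topology

universe u

section Defs

variable {X : Type u} [MetricSpace X]

/-- A normalizing sequence is a sequence of positive reals tending to zero. -/
def IsNormalizingSeq (r : ℕ → ℝ) : Prop :=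
  (∀ n, 0 < r n) ∧ Tendsto r atTop (𝓝 0)

/-- Two sequences of points of `X` are mutually stable w.r.t. `r` if
`d(x_n, y_n)/r_n` converges to a finite limit. -/
def MutuallyStable (r : ℕ → ℝ) (x y : ℕ → X) : Prop :=
  ∃ L : ℝ, Tendsto (fun n => dist (x n) (y n) / r n) atTop (𝓝 L)

/-- A family of sequences is self-stable if any two members are mutually stable. -/
def SelfStable (r : ℕ → ℝ) (F : Set (ℕ → X)) : Prop :=
  ∀ x ∈ F, ∀ y ∈ F, MutuallyStable r x y

/-- A maximal self-stable family containing the constant sequence `p`. -/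
def MaximalSelfStable (p : X) (r : ℕ → ℝ) (F : Set (ℕ → X)) : Prop :=
  SelfStable r F ∧ (fun _ => p) ∈ F ∧
    ∀ G : Set (ℕ → X), SelfStable r G → F ⊆ G → G = F

/-- `(Ω, π)` is (a realization of) the pretangent space of `X` at `p`
with respect to the normalizing sequence `r` and the maximal self-stable family
`F`; the map `π` is the metric identification projection, so that the distance
in `Ω` between `π x` and `π y` is `lim_n d(x_n,y_n)/r_n`. -/
def IsPretangentSpace (p : X) (r : ℕ → ℝ) (F : Set (ℕ → X))
    {Ω : Type u} [MetricSpace Ω] (π : (ℕ → X) → Ω) : Prop :=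
  IsNormalizingSeq r ∧ MaximalSelfStable p r F ∧
    (∀ ω : Ω, ∃ x ∈ F, π x = ω) ∧
    ∀ x ∈ F, ∀ y ∈ F,
      Tendsto (fun n => dist (x n) (y n) / r n) atTop (𝓝 (dist (π x) (π y)))

/-- The pretangent space determined by the maximal self-stable family `F` is
tangent: for every strictly increasing sequence `φ` of naturals and every
maximal self-stable family `F'` w.r.t. `r ∘ φ` containing all `x ∘ φ` with
`x ∈ F`, the canonical isometric embedding `em'` is bijective (being always an
isometric embedding it suffices that it be surjective, as stated here). -/
def IsTangentFamily (p : X) (r : ℕ → ℝ) (F : Set (ℕ → X)) : Prop :=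
  ∀ φ : ℕ → ℕ, StrictMono φ →
    ∀ F' : Set (ℕ → X), MaximalSelfStable p (r ∘ φ) F' →
      (∀ x ∈ F, x ∘ φ ∈ F') →
      ∀ y ∈ F', ∃ x ∈ F,
        Tendsto (fun k => dist (x (φ k)) (y k) / r (φ k)) atTop (𝓝 0)

/-- `δ_p(w,x,y,z) = max_i d(x_i, p)`. -/
noncomputable def delta4 (p w x y z : X) : ℝ :=
  max (dist w p) (max (dist x p) (max (dist y p) (dist z p)))

/-- `δ_p(x,y,z) = max_i d(x_i, p)`. -/
noncomputable def delta3 (p x y z : X) : ℝ :=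
  max (dist x p) (max (dist y p) (dist z p))

open Classical in
/-- The function `A₁` of Berg–Nikolaev type. -/
noncomputable def A1 (p w x y z : X) : ℝ :=
  if w = p ∧ x = p ∧ y = p ∧ z = p then 0
  else (dist w x ^ 2 + dist x y ^ 2 + dist y z ^ 2 + dist z w ^ 2
          - dist w y ^ 2 - dist x z ^ 2) / delta4 p w x y z ^ 2

open Classical in
/-- The function `A₂` of Lebedeva–Petrunin type. -/
noncomputable def A2 (p w x y z : X) : ℝ :=
  if w = p ∧ x = p ∧ y = p ∧ z = p then 0
  else (dist w x ^ 2 + dist w y ^ 2 + dist w z ^ 2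
          - (dist x y ^ 2 + dist y z ^ 2 + dist z x ^ 2) / 3) / delta4 p w x y z ^ 2

open Classical in
/-- The function `A₃` of Ptolemy type. -/
noncomputable def A3 (p w x y z : X) : ℝ :=
  if w = p ∧ x = p ∧ y = p ∧ z = p then 0
  else (dist x w * dist y z + dist x z * dist y w - dist x y * dist w z)
          / delta4 p w x y z ^ 2

open Classical in
/-- The quotient `|d(w,z) - d(x,y)/2| / δ_p(x,y)`, valued in `EReal`, with the
conventions: `0` if `x = y = p` and `z = p`, and `+∞` if `x = y = p` but `z ≠ p`. -/
noncomputable def midQuot (p w x y z : X) : EReal :=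
  if x = p ∧ y = p then (if z = p then (0 : EReal) else ⊤)
  else ((|dist w z - dist x y / 2| / max (dist x p) (dist y p) : ℝ) : EReal)

/-- `z` is an infinitesimal midpoint of the sequences `x` and `y`. -/
def IsInfinitesimalMidpoint (p : X) (x y z : ℕ → X) : Prop :=
  Tendsto (fun n => midQuot p (x n) (x n) (y n) (z n)) atTop (𝓝 (0 : EReal)) ∧
    Tendsto (fun n => midQuot p (y n) (x n) (y n) (z n)) atTop (𝓝 (0 : EReal))

/-- `X` is midpoint convex at the marked point `p`. -/
def MidpointConvexAt (p : X) : Prop :=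
  ∀ x y : ℕ → X, Tendsto x atTop (𝓝 p) → Tendsto y atTop (𝓝 p) →
    ∃ z : ℕ → X, IsInfinitesimalMidpoint p x y z

/-- `X` is Busemann convex at the marked point `p`. -/
def BusemannConvexAt (p : X) : Prop :=
  MidpointConvexAt p ∧
    ∀ x0 x1 y m : ℕ → X, Tendsto x0 atTop (𝓝 p) → Tendsto x1 atTop (𝓝 p) →
      Tendsto y atTop (𝓝 p) → IsInfinitesimalMidpoint p x0 x1 m →
      Tendsto (fun n =>
          max (dist (m n) (y n) - (dist (x0 n) (y n) + dist (x1 n) (y n)) / 2) 0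
            / delta3 p (x0 n) (y n) (x1 n)) atTop (𝓝 (0 : ℝ))

end Defs

section MetricDefs

/-- `s` is a geodesic segment with endpoints `x` and `y`: a subset isometric to
the closed interval `[0, d(x,y)]`, the endpoints of the interval corresponding
to `x` and `y`. -/
def IsGeodesicSegment {Z : Type u} [MetricSpace Z] (s : Set Z) (x y : Z) : Prop :=
  ∃ f : ℝ → Z,
    (∀ a ∈ Set.Icc 0 (dist x y), ∀ b ∈ Set.Icc 0 (dist x y),
      dist (f a) (f b) = |a - b|) ∧
    f '' Set.Icc 0 (dist x y) = s ∧ f 0 = x ∧ f (dist x y) = y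

/-- A metric space is geodesic if any two points are the endpoints of some
geodesic segment. -/
def IsGeodesicSpace (Y : Type u) [MetricSpace Y] : Prop :=
  ∀ x y : Y, ∃ s : Set Y, IsGeodesicSegment s x y

/-- `m` is a midpoint of `x` and `y`. -/
def IsMidpointOf {Z : Type u} [MetricSpace Z] (m x y : Z) : Prop :=
  dist m x = dist x y / 2 ∧ dist m y = dist x y / 2

/-- An affinely parametrized geodesic `γ : [a,b] → Z`:
`d(γ s, γ t) = λ |s - t|` for some constant `λ ≥ 0`. -/
def IsAffineGeodesic {Z : Type u} [MetricSpace Z] (γ : ℝ → Z) (a b : ℝ) : Prop :=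
  ∃ lam : ℝ, 0 ≤ lam ∧ ∀ s ∈ Set.Icc a b, ∀ t ∈ Set.Icc a b,
    dist (γ s) (γ t) = lam * |s - t|

/-- Busemann convexity of a (geodesic) metric space: for any two affinely
parametrized geodesics the joint distance function is convex. -/
def BusemannConvex (Y : Type u) [MetricSpace Y] : Prop :=
  ∀ (a b a' b' : ℝ) (γ γ' : ℝ → Y), IsAffineGeodesic γ a b →
    IsAffineGeodesic γ' a' b' →
    ConvexOn ℝ (Set.Icc a b ×ˢ Set.Icc a' b')
      (fun q : ℝ × ℝ => dist (γ q.1) (γ' q.2))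

/-- A metric space is Ptolemaic if the Ptolemy inequality holds. -/
def Ptolemaic (Y : Type u) [MetricSpace Y] : Prop :=
  ∀ x y u v : Y, dist x y * dist u v ≤ dist x u * dist y v + dist x v * dist y u

end MetricDefs


section LPProof

variable {X : Type u} [MetricSpace X]

/-- The numerator of `A₂`. -/
noncomputable def lpNum (w x y z : X) : ℝ :=
  dist w x ^ 2 + dist w y ^ 2 + dist w z ^ 2
          - (dist x y ^ 2 + dist y z ^ 2 + dist z x ^ 2) / 3

lemma delta4_pos_of_not (p w x y z : X) (h : ¬ (w = p ∧ x = p ∧ y = p ∧ z = p)) :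
    0 < delta4 p w x y z := by
  by_contra hc
  apply h
  unfold delta4 at hc
  simp only [lt_max_iff, dist_pos, not_or, not_not, ne_eq] at hc
  exact hc

lemma A2_eq_num (p w x y z : X) : A2 p w x y z = lpNum w x y z / delta4 p w x y z ^ 2 := by
  unfold A2 lpNum
  split_ifs with h
  · obtain ⟨rfl, rfl, rfl, rfl⟩ := h
    simp
  · rfl

lemma lpNum_eq_zero_of (p w x y z : X) (h : (w = p ∧ x = p ∧ y = p ∧ z = p)) :
    lpNum w x y z = 0 := by
  obtain ⟨rfl, rfl, rfl, rfl⟩ := h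
  simp [lpNum]

lemma dist_le_two_of {p a b : X} {D : ℝ} (ha : dist a p ≤ D) (hb : dist b p ≤ D) :
    dist a b ≤ 2 * D := by
  have := dist_triangle_right a b p
  linarith

lemma delta4_bounds (p w x y z : X) : dist w p ≤ delta4 p w x y z ∧ dist x p ≤ delta4 p w x y z ∧
    dist y p ≤ delta4 p w x y z ∧ dist z p ≤ delta4 p w x y z := by
  unfold delta4
  refine ⟨?_, ?_, ?_, ?_⟩ <;> simp

lemma A2_abs_le (p w x y z : X) : |A2 p w x y z| ≤ 12 := by
  rw [A2_eq_num]
  by_cases h : w = p ∧ x = p ∧ y = p ∧ z = p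
  · rw [lpNum_eq_zero_of p w x y z h]; simp
  have hp := delta4_pos_of_not p w x y z h
  obtain ⟨h1, h2, h3, h4⟩ := delta4_bounds p w x y z
  set D := delta4 p w x y z
  have key : ∀ {a b : X}, dist a p ≤ D → dist b p ≤ D → dist a b ^ 2 ≤ 4 * D ^ 2 := by
    intro a b ha hb
    have := pow_le_pow_left₀ dist_nonneg (dist_le_two_of ha hb) 2
    linarith [mul_pow 2 D 2]
  rw [abs_div, abs_of_pos (pow_pos hp 2), div_le_iff₀ (pow_pos hp 2), abs_le, lpNum]
  have a1 := key h1 h2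
  have a2 := key h1 h3
  have a3 := key h1 h4
  have a4 := key h2 h3
  have a5 := key h3 h4
  have a6 := key h4 h2
  constructor <;> nlinarith [sq_nonneg (dist w x), sq_nonneg (dist w y), sq_nonneg (dist w z),
    sq_nonneg (dist x y), sq_nonneg (dist y z), sq_nonneg (dist z x)]

/-- Zorn: every self-stable family extends to a maximal one. -/
lemma exists_maximal_selfStable (p : X) (r : ℕ → ℝ) (S : Set (ℕ → X)) (hS : SelfStable r S)
    (hp : (fun _ => p) ∈ S) : ∃ F, S ⊆ F ∧ MaximalSelfStable p r F := by
  obtain ⟨F, hSF, hF⟩ := zorn_subset_nonempty {G : Set (ℕ → X) | SelfStable r G} (by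
    intro c hc hchain hne
    refine ⟨⋃₀ c, ?_, fun s hs => Set.subset_sUnion_of_mem hs⟩
    rintro x ⟨A, hA, hxA⟩ y ⟨B, hB, hyB⟩
    rcases hchain.total hA hB with h | h
    · exact hc hB x (h hxA) y hyB
    · exact hc hA x hxA y (h hyB)) S hS
  exact ⟨F, hSF, hF.prop, hSF hp, fun G hG hFG => (hF.eq_of_subset hG hFG).symm⟩

lemma exists_metric_identification (T : Type u) (M : PseudoMetricSpace T) :
    ∃ (Ω : Type u) (_ : MetricSpace Ω) (f : T → Ω), Function.Surjective f ∧
      ∀ x y, dist (f x) (f y) = M.dist x y :=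
  ⟨SeparationQuotient T, inferInstance, SeparationQuotient.mk,
    SeparationQuotient.surjective_mk, fun x y => SeparationQuotient.dist_mk x y⟩

/-- Existence of the pretangent space of a maximal self-stable family. -/
lemma exists_pretangent (p : X) (r : ℕ → ℝ) (F : Set (ℕ → X)) (hr : IsNormalizingSeq r)
    (hF : MaximalSelfStable p r F) :
    ∃ (Ω : Type u) (_ : MetricSpace Ω) (π : (ℕ → X) → Ω), IsPretangentSpace p r F π := by
  classical
  choose L hL using hF.1
  let M : PseudoMetricSpace F :=
    { dist := fun x y => L x.1 x.2 y.1 y.2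
      dist_self := fun x => by
        refine tendsto_nhds_unique (hL x.1 x.2 x.1 x.2) ?_
        simp
      dist_comm := fun x y => by
        refine tendsto_nhds_unique (hL x.1 x.2 y.1 y.2) ?_
        simpa only [dist_comm] using hL y.1 y.2 x.1 x.2
      dist_triangle := fun x y z => by
        refine le_of_tendsto_of_tendsto' (hL x.1 x.2 z.1 z.2)
          ((hL x.1 x.2 y.1 y.2).add (hL y.1 y.2 z.1 z.2)) fun n => ?_
        rw [← add_div]
        exact div_le_div_of_nonneg_right (dist_triangle _ _ _) (hr.1 n).le }
  obtain ⟨Ω, _, f, hf, hfd⟩ := exists_metric_identification F M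
  refine ⟨Ω, inferInstance, fun x => if h : x ∈ F then f ⟨x, h⟩
      else f ⟨_, hF.2.1⟩, hr, hF, ?_, ?_⟩
  · intro ω
    obtain ⟨⟨x, hx⟩, rfl⟩ := hf ω
    exact ⟨x, hx, by simp [hx]⟩
  · intro x hx y hy
    simp only [hx, hy, dite_true, hfd]
    exact hL x hx y hy

lemma lpNum_tendsto {r : ℕ → ℝ} {w x y z : ℕ → X} {a b c d e f : ℝ}
    (h1 : Tendsto (fun n => dist (w n) (x n) / r n) atTop (𝓝 a))
    (h2 : Tendsto (fun n => dist (w n) (y n) / r n) atTop (𝓝 b))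
    (h3 : Tendsto (fun n => dist (w n) (z n) / r n) atTop (𝓝 c))
    (h4 : Tendsto (fun n => dist (x n) (y n) / r n) atTop (𝓝 d))
    (h5 : Tendsto (fun n => dist (y n) (z n) / r n) atTop (𝓝 e))
    (h6 : Tendsto (fun n => dist (z n) (x n) / r n) atTop (𝓝 f)) :
    Tendsto (fun n => lpNum (w n) (x n) (y n) (z n) / r n ^ 2) atTop
      (𝓝 (a ^ 2 + b ^ 2 + c ^ 2 - (d ^ 2 + e ^ 2 + f ^ 2) / 3)) := by
  refine ((((h1.pow 2).add (h2.pow 2)).add (h3.pow 2)).sub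
    ((((h4.pow 2).add (h5.pow 2)).add (h6.pow 2)).div_const 3)).congr fun n => ?_
  simp only [lpNum, div_pow]
  ring

lemma tendsto_point_of_stable {p : X} {r : ℕ → ℝ} {x : ℕ → X} {L : ℝ} (hr : IsNormalizingSeq r)
    (h : Tendsto (fun n => dist (x n) p / r n) atTop (𝓝 L)) : Tendsto x atTop (𝓝 p) := by
  rw [tendsto_iff_dist_tendsto_zero]
  have := h.mul hr.2
  rw [mul_zero] at this
  refine this.congr fun n => ?_
  exact div_mul_cancel₀ _ (hr.1 n).ne'

lemma LP_forward (p : X)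
    (H : ∀ (r : ℕ → ℝ) (F : Set (ℕ → X)) (Ω : Type u) [MetricSpace Ω]
        (π : (ℕ → X) → Ω), IsPretangentSpace p r F π →
        ∀ α β γ η : Ω, (dist α β ^ 2 + dist β γ ^ 2 + dist γ α ^ 2) / 3 ≤
          dist α η ^ 2 + dist β η ^ 2 + dist γ η ^ 2) (ε : ℝ) (hε : 0 < ε) :
    ∀ᶠ q : X × X × X × X in 𝓝 (p, p, p, p), -ε ≤ A2 p q.1 q.2.1 q.2.2.1 q.2.2.2 := by
  by_contra hc
  rw [not_eventually] at hc
  obtain ⟨q, hq, hqA⟩ := exists_seq_forall_of_frequently hc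
  simp only [not_le] at hqA
  -- the five sequences
  let s : ℕ → Fin 5 → X := fun n => ![p, (q n).1, (q n).2.1, (q n).2.2.1, (q n).2.2.2]
  let D : ℕ → ℝ := fun n => delta4 p (q n).1 (q n).2.1 (q n).2.2.1 (q n).2.2.2
  have hDpos : ∀ n, 0 < D n := by
    intro n
    apply delta4_pos_of_not
    intro h
    have := hqA n
    rw [A2_eq_num, lpNum_eq_zero_of p _ _ _ _ h] at this
    simp at this
    linarith
  have hD0 : Tendsto D atTop (𝓝 0) := by
    have hcont : Continuous fun q : X × X × X × X => delta4 p q.1 q.2.1 q.2.2.1 q.2.2.2 := by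
      unfold delta4; fun_prop
    have := (hcont.tendsto (p, p, p, p)).comp hq
    have h0 : delta4 p p p p p = 0 := by simp [delta4]
    rw [h0] at this
    exact this
  have hsD : ∀ n i, dist (s n i) p ≤ D n := by
    intro n i
    obtain ⟨h1, h2, h3, h4⟩ := delta4_bounds p (q n).1 (q n).2.1 (q n).2.2.1 (q n).2.2.2
    fin_cases i
    · simpa [s] using (hDpos n).le
    · exact h1
    · exact h2
    · exact h3
    · exact h4
  let R : ℕ → (Fin 5 → Fin 5 → ℝ) := fun n i j => dist (s n i) (s n j) / D n
  have hR : ∀ n, R n ∈ Set.Icc (fun _ _ => (0:ℝ)) (fun _ _ => (2:ℝ)) := by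
    intro n
    refine ⟨fun i j => div_nonneg dist_nonneg (hDpos n).le, fun i j => ?_⟩
    exact (div_le_iff₀ (hDpos n)).2 (dist_le_two_of (hsD n i) (hsD n j))
  obtain ⟨L, -, φ, hφ, hlim⟩ := isCompact_Icc.tendsto_subseq hR
  have hlim' : ∀ i j, Tendsto (fun n => dist (s (φ n) i) (s (φ n) j) / D (φ n)) atTop
      (𝓝 (L i j)) := fun i j => (tendsto_pi_nhds.1 (tendsto_pi_nhds.1 hlim i) j)
  let r : ℕ → ℝ := fun n => D (φ n)
  have hr : IsNormalizingSeq r := ⟨fun n => hDpos _, hD0.comp hφ.tendsto_atTop⟩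
  let t : Fin 5 → ℕ → X := fun i n => s (φ n) i
  obtain ⟨F, hSF, hF⟩ := exists_maximal_selfStable p r (Set.range t) (by
    rintro _ ⟨i, rfl⟩ _ ⟨j, rfl⟩
    exact ⟨_, hlim' i j⟩) ⟨0, rfl⟩
  obtain ⟨Ω, _, π, hπ⟩ := exists_pretangent p r F hr hF
  have ht : ∀ i, t i ∈ F := fun i => hSF ⟨i, rfl⟩
  have hd := fun i j => hπ.2.2.2 (t i) (ht i) (t j) (ht j)
  have hN := lpNum_tendsto (hd 1 2) (hd 1 3) (hd 1 4) (hd 2 3) (hd 3 4) (hd 4 2)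
  have hle := le_of_tendsto' hN (b := -ε) (fun n => by
    have := (hqA (φ n)).le
    rw [A2_eq_num] at this
    exact this)
  have := H r F Ω π hπ (π (t 2)) (π (t 3)) (π (t 4)) (π (t 1))
  rw [dist_comm (π (t 2)) (π (t 1)), dist_comm (π (t 3)) (π (t 1)),
    dist_comm (π (t 4)) (π (t 1))] at this
  linarith

lemma LP_backward (p : X)
    (H : ∀ ε : ℝ, 0 < ε →
      ∀ᶠ q : X × X × X × X in 𝓝 (p, p, p, p), -ε ≤ A2 p q.1 q.2.1 q.2.2.1 q.2.2.2)
    (r : ℕ → ℝ) (F : Set (ℕ → X)) (Ω : Type u) [MetricSpace Ω]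
    (π : (ℕ → X) → Ω) (hπ : IsPretangentSpace p r F π) (α β γ η : Ω) :
    (dist α β ^ 2 + dist β γ ^ 2 + dist γ α ^ 2) / 3 ≤
          dist α η ^ 2 + dist β η ^ 2 + dist γ η ^ 2 := by
  obtain ⟨hr, hF, hsurj, hd⟩ := hπ
  obtain ⟨x, hx, rfl⟩ := hsurj α
  obtain ⟨y, hy, rfl⟩ := hsurj β
  obtain ⟨z, hz, rfl⟩ := hsurj γ
  obtain ⟨w, hw, rfl⟩ := hsurj η
  have hN := lpNum_tendsto (hd w hw x hx) (hd w hw y hy) (hd w hw z hz) (hd x hx y hy)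
    (hd y hy z hz) (hd z hz x hx)
  have ep := hF.2.1
  have pw := hd w hw _ ep
  have px := hd x hx _ ep
  have py := hd y hy _ ep
  have pz := hd z hz _ ep
  have hq : Tendsto (fun n => (w n, x n, y n, z n)) atTop (𝓝 (p, p, p, p)) :=
    (tendsto_point_of_stable hr pw).prodMk_nhds ((tendsto_point_of_stable hr px).prodMk_nhds
      ((tendsto_point_of_stable hr py).prodMk_nhds (tendsto_point_of_stable hr pz)))
  have hM := (pw.max (px.max (py.max pz))).pow 2
  set K := (max (dist (π w) (π fun _ => p)) (max (dist (π x) (π fun _ => p))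
    (max (dist (π y) (π fun _ => p)) (dist (π z) (π fun _ => p))))) ^ 2 with hK
  have key : ∀ ε : ℝ, 0 < ε → -ε * K ≤ _ := fun ε hε =>
    le_of_tendsto_of_tendsto (hM.const_mul (-ε)) hN (by
      filter_upwards [hq.eventually (H ε hε)] with n hn
      have hrn := hr.1 n
      rw [A2_eq_num] at hn
      have h2 : -ε * delta4 p (w n) (x n) (y n) (z n) ^ 2 ≤ lpNum (w n) (x n) (y n) (z n) := by
        by_cases h : w n = p ∧ x n = p ∧ y n = p ∧ z n = p
        · rw [lpNum_eq_zero_of p _ _ _ _ h]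
          nlinarith [sq_nonneg (delta4 p (w n) (x n) (y n) (z n))]
        · exact (le_div_iff₀ (pow_pos (delta4_pos_of_not p _ _ _ _ h) 2)).1 hn
      rw [max_div_div_right hrn.le, max_div_div_right hrn.le, max_div_div_right hrn.le]
      rw [div_pow, ← mul_div_assoc]
      exact div_le_div_of_nonneg_right h2 (sq_nonneg _))
  have hlim : Tendsto (fun ε : ℝ => -ε * K) (𝓝[>] 0) (𝓝 0) := by
    have : Continuous fun ε : ℝ => -ε * K := by fun_prop
    have := this.tendsto 0
    simp only [neg_zero, zero_mul] at this
    exact this.mono_left nhdsWithin_le_nhds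
  have := le_of_tendsto hlim (by
    filter_upwards [self_mem_nhdsWithin] with ε hε
    exact key ε hε)
  rw [dist_comm (π x) (π w), dist_comm (π y) (π w), dist_comm (π z) (π w)]
  linarith

end LPProof

/-- the Lebedeva–Petrunin inequality holds in every pretangent
space iff `liminf_{w,x,y,z → p} A₂(w,x,y,z) ≥ 0`. -/
theorem pretangent_LP_ineq_iff_liminf_A2_nonneg
    {X : Type u} [MetricSpace X] (p : X) :
    (∀ (r : ℕ → ℝ) (F : Set (ℕ → X)) (Ω : Type u) [MetricSpace Ω]
        (π : (ℕ → X) → Ω), IsPretangentSpace p r F π →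
        ∀ α β γ η : Ω, (dist α β ^ 2 + dist β γ ^ 2 + dist γ α ^ 2) / 3 ≤
          dist α η ^ 2 + dist β η ^ 2 + dist γ η ^ 2) ↔
      0 ≤ liminf (fun q : X × X × X × X => A2 p q.1 q.2.1 q.2.2.1 q.2.2.2)
          (𝓝 (p, p, p, p)) := by
  have hub : IsBoundedUnder (· ≤ ·) (𝓝 (p, p, p, p))
      (fun q : X × X × X × X => A2 p q.1 q.2.1 q.2.2.1 q.2.2.2) :=
    isBoundedUnder_of ⟨12, fun q => (abs_le.1 (A2_abs_le p _ _ _ _)).2⟩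
  have hlb : IsBoundedUnder (· ≥ ·) (𝓝 (p, p, p, p))
      (fun q : X × X × X × X => A2 p q.1 q.2.1 q.2.2.1 q.2.2.2) :=
    isBoundedUnder_of ⟨-12, fun q => (abs_le.1 (A2_abs_le p _ _ _ _)).1⟩
  constructor
  · intro H
    refine le_of_forall_pos_le_add fun ε hε => ?_
    have := le_liminf_of_le hub.isCoboundedUnder_ge (LP_forward p H ε hε)
    linarith
  · intro H r F Ω _ π hπ α β γ η
    refine LP_backward p (fun ε hε => ?_) r F Ω π hπ α β γ η
    have h : -ε < liminf (fun q : X × X × X × X => A2 p q.1 q.2.1 q.2.2.1 q.2.2.2)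
          (𝓝 (p, p, p, p)) := by linarith
    exact (eventually_lt_of_lt_liminf h hlb).mono fun q hq => hq.le
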